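/- Let G be a group acting on a set E. Let (G, 𝒜, μ) be a finite mean space on G invariant by left translations, and let (E, ℱ, m) be a finite mean space on E invariant by the action of G. Let A ∈ 𝒜 and B ∈ ℱ satisfy μ(A) > 0 and m(B) > 0, and assume that A'·B ∈ ℱ for any A' which is a finite intersection of left translates of A. Then, for any n ∈ ℕ, there is a symmetric subset S ⊆ G such that G is covered by finitely many left translates of S and Sⁿ ⊆ S(AB) := {g ∈ G : gA·B ∩ A·B ≠ ∅}. -/

import Mathlib

open Pointwise ENNReal

/-- A mean space: a lattice of sets `𝒜` containing `∅` together with a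
monotone additive function `μ` with `μ ∅ = 0`. -/
structure IsMeanSpace {E : Type*} (𝒜 : Set (Set E)) (μ : Set E → ℝ≥0∞) : Prop where
  empty_mem : ∅ ∈ 𝒜
  union_mem : ∀ A ∈ 𝒜, ∀ B ∈ 𝒜, A ∪ B ∈ 𝒜
  inter_mem : ∀ A ∈ 𝒜, ∀ B ∈ 𝒜, A ∩ B ∈ 𝒜
  measure_empty : μ ∅ = 0
  mono : ∀ A ∈ 𝒜, ∀ B ∈ 𝒜, A ⊆ B → μ A ≤ μ B
  union_add : ∀ A ∈ 𝒜, ∀ B ∈ 𝒜, μ (A ∩ B) < ⊤ → μ (A ∪ B) = μ A + μ B - μ (A ∩ B)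

/-- A mean space is finite if the whole set belongs to the family and has
finite mean. -/
def IsFiniteMeanSpace {E : Type*} (𝒜 : Set (Set E)) (μ : Set E → ℝ≥0∞) : Prop :=
  Set.univ ∈ 𝒜 ∧ μ Set.univ < ⊤

/-- A mean space on a group is invariant by left translations. -/
def IsLeftInvariant {G : Type*} [Group G] (𝒜 : Set (Set G)) (μ : Set G → ℝ≥0∞) : Prop :=
  ∀ g : G, ∀ A ∈ 𝒜, g • A ∈ 𝒜 ∧ μ (g • A) = μ A

/-- A mean space on `E` is invariant by the action of `G`. -/
def IsActionInvariant {G E : Type*} [Group G] [MulAction G E]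
    (ℱ : Set (Set E)) (m : Set E → ℝ≥0∞) : Prop :=
  ∀ g : G, ∀ B ∈ ℱ, g • B ∈ ℱ ∧ m (g • B) = m B

namespace IsMeanSpace

variable {E : Type*} {𝒜 : Set (Set E)} {μ : Set E → ℝ≥0∞}

theorem lt_top (h : IsMeanSpace 𝒜 μ) (hfin : IsFiniteMeanSpace 𝒜 μ) {P : Set E} (hP : P ∈ 𝒜) :
    μ P < ⊤ :=
  (h.mono _ hP _ hfin.1 (Set.subset_univ P)).trans_lt hfin.2

theorem union_add_inter (h : IsMeanSpace 𝒜 μ) (hfin : IsFiniteMeanSpace 𝒜 μ) {P Q : Set E}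
    (hP : P ∈ 𝒜) (hQ : Q ∈ 𝒜) : μ (P ∪ Q) + μ (P ∩ Q) = μ P + μ Q := by
  rw [h.union_add P hP Q hQ (h.lt_top hfin (h.inter_mem P hP Q hQ))]
  exact tsub_add_cancel_of_le
    ((h.mono _ (h.inter_mem P hP Q hQ) _ hP Set.inter_subset_left).trans le_self_add)

theorem biUnion_mem (h : IsMeanSpace 𝒜 μ) {ι : Type*} (s : Finset ι) {F : ι → Set E}
    (hF : ∀ i, F i ∈ 𝒜) : (⋃ i ∈ s, F i) ∈ 𝒜 := by
  classical
  induction s using Finset.induction_on with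
  | empty => simpa using h.empty_mem
  | insert a s _ ih =>
    rw [Finset.set_biUnion_insert]
    exact h.union_mem _ (hF a) _ ih

theorem biInter_mem (h : IsMeanSpace 𝒜 μ) {ι : Type*} {s : Finset ι} (hs : s.Nonempty)
    {F : ι → Set E} (hF : ∀ i, F i ∈ 𝒜) : (⋂ i ∈ s, F i) ∈ 𝒜 := by
  classical
  induction hs using Finset.Nonempty.cons_induction with
  | singleton a => simpa using hF a
  | cons a s _ _ ih =>
    rw [Finset.cons_eq_insert, Finset.set_biInter_insert]
    exact h.inter_mem _ (hF a) _ ih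

theorem measure_inter_biUnion_eq_zero (h : IsMeanSpace 𝒜 μ) (hfin : IsFiniteMeanSpace 𝒜 μ)
    {ι : Type*} {s : Finset ι} {F : ι → Set E} (hF : ∀ i, F i ∈ 𝒜) {P : Set E} (hP : P ∈ 𝒜)
    (h0 : ∀ i ∈ s, μ (P ∩ F i) = 0) : μ (P ∩ ⋃ i ∈ s, F i) = 0 := by
  classical
  induction s using Finset.induction_on with
  | empty => simpa using h.measure_empty
  | insert a s _ ih =>
    rw [Finset.set_biUnion_insert, Set.inter_union_distrib_left]
    have key := h.union_add_inter hfin (h.inter_mem _ hP _ (hF a))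
      (h.inter_mem _ hP _ (h.biUnion_mem s hF))
    rw [h0 a (Finset.mem_insert_self a s),
      ih fun i hi => h0 i (Finset.mem_insert_of_mem hi), add_zero] at key
    exact (add_eq_zero.mp key).1

end IsMeanSpace

/-- In a finite left-invariant mean space, the set of `g` for which `g • P` meets `P` in positive
mean is left syndetic as soon as `P` has positive mean. -/
theorem exists_finite_mul_setOf_measure_smul_inter_pos {G : Type*} [Group G]
    {𝒜 : Set (Set G)} {μ : Set G → ℝ≥0∞} (h : IsMeanSpace 𝒜 μ) (hfin : IsFiniteMeanSpace 𝒜 μ)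
    (hinv : IsLeftInvariant 𝒜 μ) {P : Set G} (hP : P ∈ 𝒜) (hP0 : 0 < μ P) :
    ∃ Δ : Set G, Δ.Finite ∧ (Set.univ : Set G) ⊆ Δ * {g : G | 0 < μ (g • P ∩ P)} := by
  classical
  by_contra! hcon
  have hF : ∀ g : G, g • P ∈ 𝒜 := fun g => (hinv g P hP).1
  have packing : ∀ N : ℕ, ∃ Δ : Finset G, N * μ P ≤ μ (⋃ g ∈ Δ, g • P) := by
    intro N
    induction N with
    | zero => exact ⟨∅, by simp⟩
    | succ N ih =>
      obtain ⟨Δ, hΔ⟩ := ih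
      obtain ⟨g, -, hg⟩ := Set.not_subset.mp (hcon Δ Δ.finite_toSet)
      refine ⟨insert g Δ, ?_⟩
      have h0 : ∀ d ∈ Δ, μ (g • P ∩ d • P) = 0 := by
        intro d hd
        by_contra hne
        refine hg (Set.mem_mul.mpr ⟨d, hd, d⁻¹ * g, ?_, by group⟩)
        have htrans : g • P ∩ d • P = d • ((d⁻¹ * g) • P ∩ P) := by
          rw [Set.smul_set_inter, smul_smul, mul_inv_cancel_left]
        rw [htrans, (hinv d _ (h.inter_mem _ (hF _) _ hP)).2] at hne
        exact pos_iff_ne_zero.mpr hne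
      have key := h.union_add_inter hfin (hF g) (h.biUnion_mem Δ hF)
      rw [h.measure_inter_biUnion_eq_zero hfin hF (hF g) h0, add_zero, (hinv g P hP).2] at key
      rw [Finset.set_biUnion_insert, key, Nat.cast_succ, add_mul, one_mul, add_comm]
      gcongr
  obtain ⟨N, hN⟩ := ENNReal.exists_nat_mul_gt hP0.ne' hfin.2.ne
  obtain ⟨Δ, hΔ⟩ := packing N
  exact absurd (hΔ.trans (h.mono _ (h.biUnion_mem Δ hF) _ hfin.1 (Set.subset_univ _))) hN.not_ge

/-- If every `g ∈ X` moves `C` by an error at most `e`, then every element of `X ^ k` moves it by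
an error at most `k * e`. -/
theorem measure_le_measure_smul_inter_add {G E : Type*} [Group G] [MulAction G E]
    {ℱ : Set (Set E)} {m : Set E → ℝ≥0∞} (h : IsMeanSpace ℱ m) (hfin : IsFiniteMeanSpace ℱ m)
    (hinv : IsActionInvariant (G := G) ℱ m) {C : Set E} (hC : C ∈ ℱ) {X : Set G} {e : ℝ≥0∞}
    (hX : ∀ g ∈ X, m C ≤ m (g • C ∩ C) + e) (k : ℕ) :
    ∀ g ∈ X ^ k, m C ≤ m (g • C ∩ C) + k * e := by
  have hF : ∀ g : G, g • C ∈ ℱ := fun g => (hinv g C hC).1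
  induction k with
  | zero =>
    intro g hg
    obtain rfl : g = 1 := by simpa using hg
    simp
  | succ k ih =>
    intro x hx
    rw [pow_succ] at hx
    obtain ⟨a, ha, g, hg, rfl⟩ := Set.mem_mul.mp hx
    have hP : a • (g • C ∩ C) ∈ ℱ := (hinv a _ (h.inter_mem _ (hF g) _ hC)).1
    have hQ : a • C ∩ C ∈ ℱ := h.inter_mem _ (hF a) _ hC
    have hunion : m (a • (g • C ∩ C) ∪ (a • C ∩ C)) ≤ m C := by
      rw [← (hinv a C hC).2]
      exact h.mono _ (h.union_mem _ hP _ hQ) _ (hF a) (Set.union_subset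
        (Set.smul_set_mono Set.inter_subset_right) Set.inter_subset_left)
    have hinter : m (a • (g • C ∩ C) ∩ (a • C ∩ C)) ≤ m ((a * g) • C ∩ C) := by
      refine h.mono _ (h.inter_mem _ hP _ hQ) _ (h.inter_mem _ (hF _) _ hC)
        (Set.inter_subset_inter ?_ Set.inter_subset_right)
      rw [mul_smul]
      exact Set.smul_set_mono Set.inter_subset_left
    have key := h.union_add_inter hfin hP hQ
    rw [(hinv a _ (h.inter_mem _ (hF g) _ hC)).2] at key
    refine (ENNReal.add_le_add_iff_left (h.lt_top hfin hC).ne).mp ?_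
    calc m C + m C ≤ (m (g • C ∩ C) + e) + (m (a • C ∩ C) + k * e) :=
          add_le_add (hX g hg) (ih a ha)
      _ = (m (g • C ∩ C) + m (a • C ∩ C)) + (k + 1) * e := by ring
      _ ≤ (m C + m ((a * g) • C ∩ C)) + (k + 1) * e := by
          rw [← key]; gcongr
      _ = m C + (m ((a * g) • C ∩ C) + (k + 1 : ℕ) * e) := by push_cast; ring

/-- The finite nonempty intersections of left translates of `A`. -/
def translateInters {G : Type*} [Group G] (A : Set G) : Set (Set G) :=
  {A' | ∃ s : Finset G, s.Nonempty ∧ A' = ⋂ g ∈ s, g • A}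

section translateInters

variable {G : Type*} [Group G] {A P Q : Set G}

theorem self_mem_translateInters : A ∈ translateInters A :=
  ⟨{1}, Finset.singleton_nonempty 1, by simp⟩

theorem smul_mem_translateInters (g : G) (hP : P ∈ translateInters A) :
    g • P ∈ translateInters A := by
  classical
  obtain ⟨s, hs, rfl⟩ := hP
  refine ⟨s.image (g * ·), hs.image _, ?_⟩
  rw [Finset.set_biInter_finset_image]
  simp only [Set.smul_set_iInter, mul_smul]

theorem inter_mem_translateInters (hP : P ∈ translateInters A) (hQ : Q ∈ translateInters A) :
    P ∩ Q ∈ translateInters A := by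
  classical
  obtain ⟨s, hs, rfl⟩ := hP
  obtain ⟨t, -, rfl⟩ := hQ
  exact ⟨s ∪ t, hs.mono Finset.subset_union_left, (Finset.iInf_union (f := fun g => g • A)).symm⟩

theorem exists_smul_subset_of_mem_translateInters (hP : P ∈ translateInters A) :
    ∃ g : G, g • P ⊆ A := by
  obtain ⟨s, ⟨g, hg⟩, rfl⟩ := hP
  exact ⟨g⁻¹, Set.smul_set_subset_iff_subset_inv_smul_set.mpr (by
    simpa using Set.biInter_subset_of_mem (t := fun g => g • A) hg)⟩

end translateInters

/-- Basic Massicot-Wagner, finite mean version: given a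
left-invariant finite mean space `(G, 𝒜, μ)` and a `G`-invariant finite mean
space `(E, ℱ, m)`, `A ∈ 𝒜` with `μ(A) > 0`, `B ∈ ℱ` with `m(B) > 0`, and
`A'·B ∈ ℱ` for any finite intersection of translates `A'` of `A`, for any `n`
there is a symmetric `S ⊆ G` such that finitely many left translates of `S`
cover `G` and `Sⁿ ⊆ S(AB) = {g ∈ G : gA·B ∩ A·B ≠ ∅}`. -/
theorem stmt_16 {G E : Type*} [Group G] [MulAction G E]
    (𝒜 : Set (Set G)) (μ : Set G → ℝ≥0∞)
    (hμmean : IsMeanSpace 𝒜 μ) (hμfin : IsFiniteMeanSpace 𝒜 μ)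
    (hμinv : IsLeftInvariant 𝒜 μ)
    (ℱ : Set (Set E)) (m : Set E → ℝ≥0∞)
    (hmmean : IsMeanSpace ℱ m) (hmfin : IsFiniteMeanSpace ℱ m)
    (hminv : IsActionInvariant (G := G) ℱ m)
    (A : Set G) (hA : A ∈ 𝒜) (hA0 : 0 < μ A)
    (B : Set E) (hB : B ∈ ℱ) (hB0 : 0 < m B)
    (ha : ∀ A' : Set G, (∃ s : Finset G, s.Nonempty ∧ A' = ⋂ g ∈ s, g • A) →
      A' • B ∈ ℱ)
    (n : ℕ) :
    ∃ S : Set G, S⁻¹ = S ∧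
      (∃ Δ : Set G, Δ.Finite ∧ (Set.univ : Set G) ⊆ Δ * S) ∧
      S ^ n ⊆ {g : G | ((g • (A • B)) ∩ A • B).Nonempty} := by
  have hT : ∀ P ∈ translateInters A, P ∈ 𝒜 := by
    rintro _ ⟨s, hs, rfl⟩
    exact hμmean.biInter_mem hs fun g => (hμinv g A hA).1
  set V : Set (Set G) := {P | P ∈ translateInters A ∧ 0 < μ P}
  set L : ℝ≥0∞ := ⨅ P ∈ V, m (P • B)
  have hL_le : ∀ P ∈ V, L ≤ m (P • B) := fun P hP => iInf₂_le P hP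
  have hAV : A ∈ V := ⟨self_mem_translateInters, hA0⟩
  have hL0 : 0 < L := by
    refine hB0.trans_le (le_iInf₂ fun P hP => ?_)
    obtain ⟨a, haP⟩ : P.Nonempty := by
      rw [Set.nonempty_iff_ne_empty]
      rintro rfl
      exact hP.2.ne' hμmean.measure_empty
    rw [← (hminv a B hB).2]
    exact hmmean.mono _ (hminv a B hB).1 _ (ha P hP.1) (Set.smul_set_subset_smul haP)
  have hLtop : L ≠ ⊤ := ((hL_le A hAV).trans_lt (hmmean.lt_top hmfin (ha A hAV.1))).ne
  set e : ℝ≥0∞ := L / (n + 1 : ℕ)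
  have hn1 : ((n + 1 : ℕ) : ℝ≥0∞) ≠ 0 := by exact_mod_cast n.succ_ne_zero
  have he0 : e ≠ 0 := ENNReal.div_ne_zero.mpr ⟨hL0.ne', ENNReal.natCast_ne_top _⟩
  have hetop : e ≠ ⊤ := ENNReal.div_ne_top hLtop hn1
  have hne : n * e < L := by
    have hsum : (n + 1 : ℕ) * e = L := ENNReal.mul_div_cancel hn1 (ENNReal.natCast_ne_top _)
    rw [← hsum, Nat.cast_succ, add_mul, one_mul]
    exact ENNReal.lt_add_right (ENNReal.mul_ne_top (ENNReal.natCast_ne_top _) hetop) he0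
  obtain ⟨P, hPT, hP0, hPA, hPL⟩ :
      ∃ P ∈ translateInters A, 0 < μ P ∧ P ⊆ A ∧ m (P • B) < L + e := by
    obtain ⟨P, hPL⟩ := iInf_lt_iff.mp (ENNReal.lt_add_right hLtop he0)
    obtain ⟨hP, hPL⟩ := iInf_lt_iff.mp hPL
    obtain ⟨g, hg⟩ := exists_smul_subset_of_mem_translateInters hP.1
    refine ⟨g • P, smul_mem_translateInters g hP.1, ?_, hg, ?_⟩
    · rw [(hμinv g P (hT P hP.1)).2]
      exact hP.2
    · rw [smul_assoc, (hminv g _ (ha P hP.1)).2]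
      exact hPL
  have hPmem := hT P hPT
  have hX : ∀ g ∈ {g : G | 0 < μ (g • P ∩ P)}, m (P • B) ≤ m (g • (P • B) ∩ P • B) + e := by
    intro g hg
    have hgT := inter_mem_translateInters (smul_mem_translateInters g hPT) hPT
    refine hPL.le.trans (add_le_add_left ((hL_le _ ⟨hgT, hg⟩).trans ?_) e)
    refine hmmean.mono _ (ha _ hgT) _
      (hmmean.inter_mem _ (hminv g _ (ha P hPT)).1 _ (ha P hPT)) ?_
    rw [← smul_assoc]
    exact Set.inter_smul_subset
  refine ⟨{g : G | 0 < μ (g • P ∩ P)}, ?_,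
    exists_finite_mul_setOf_measure_smul_inter_pos hμmean hμfin hμinv hPmem hP0, ?_⟩
  · ext g
    have hinv : g⁻¹ • P ∩ P = g⁻¹ • (g • P ∩ P) := by
      rw [Set.smul_set_inter, inv_smul_smul, Set.inter_comm]
    rw [Set.mem_inv, Set.mem_ofPred_eq, Set.mem_ofPred_eq, hinv,
      (hμinv _ _ (hμmean.inter_mem _ (hμinv g P hPmem).1 _ hPmem)).2]
  · intro g hg
    have hle := measure_le_measure_smul_inter_add hmmean hmfin hminv (ha P hPT) hX n g hg
    have hsub : P • B ⊆ A • B := Set.smul_subset_smul_right hPA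
    refine Set.Nonempty.mono (Set.inter_subset_inter (Set.smul_set_mono hsub) hsub) ?_
    rw [Set.nonempty_iff_ne_empty]
    intro hempty
    rw [hempty, hmmean.measure_empty, zero_add] at hle
    exact absurd ((hL_le P ⟨hPT, hP0⟩).trans hle) hne.not_ge
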